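/- Let u solve the obstacle problem in K_{g,h}(Ω,Ω'). If B_r is an open ball with B_r ⊂ Ω and essinf_{B_r} (u − h) > 0, then u is a weak solution of Lu = 0 in B_r, i.e. ∫_{ℝ^n}∫_{ℝ^n} K(x,y) L(u(x),u(y)) (η(x)−η(y)) dx dy = 0 for every η ∈ C_0^∞(B_r). In particular, if u is lower semicontinuous and h is upper semicontinuous in Ω, then u is a weak solution of Lu = 0 in the open set Ω₊ := { x ∈ Ω : u(x) > h(x) }. -/

import Mathlib

open MeasureTheory Metric Filter
open scoped ENNReal Topology

noncomputable section

/-- `ℝ^n`. -/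
abbrev Euc (n : ℕ) := EuclideanSpace ℝ (Fin n)

/-- `L(a,b) = |a-b|^{p-2}(a-b)` (real powers; the convention `L(a,a)=0` holds automatically). -/
noncomputable def Lf (p a b : ℝ) : ℝ := |a - b| ^ (p - 2) * (a - b)

/-- A symmetric measurable kernel of order `(s,p)` with ellipticity constant `Λ`. -/
def IsKernel (n : ℕ) (s p Λ : ℝ) (K : Euc n → Euc n → ℝ) : Prop :=
  Measurable (Function.uncurry K) ∧
  (∀ x y, K x y = K y x) ∧ (∀ x y, 0 ≤ K x y) ∧
  (∀ᵐ z : Euc n × Euc n, Λ⁻¹ ≤ K z.1 z.2 * ‖z.1 - z.2‖ ^ ((n : ℝ) + s * p) ∧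
    K z.1 z.2 * ‖z.1 - z.2‖ ^ ((n : ℝ) + s * p) ≤ Λ)

/-- Membership in the fractional Sobolev space `W^{s,p}(D)` (finiteness of the norm). -/
def MemW (n : ℕ) (s p : ℝ) (D : Set (Euc n)) (v : Euc n → ℝ) : Prop :=
  AEMeasurable v (volume.restrict D) ∧
  IntegrableOn (fun x => |v x| ^ p) D volume ∧
  Integrable (fun q : Euc n × Euc n => |v q.1 - v q.2| ^ p / ‖q.1 - q.2‖ ^ ((n : ℝ) + s * p))
    ((volume.restrict D).prod (volume.restrict D))

/-- The `W^{s,p}(D)` norm. -/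
noncomputable def sobNorm (n : ℕ) (s p : ℝ) (D : Set (Euc n)) (v : Euc n → ℝ) : ℝ :=
  (∫ x in D, |v x| ^ p) ^ (1/p) +
  (∫ x in D, ∫ y in D, |v x - v y| ^ p / ‖x - y‖ ^ ((n : ℝ) + s * p)) ^ (1/p)

/-- The nonlocal tail `Tail(f; z, r)`. -/
noncomputable def tailF (n : ℕ) (s p : ℝ) (f : Euc n → ℝ) (z : Euc n) (r : ℝ) : ℝ :=
  (r ^ (s * p) * ∫ x in (ball z r)ᶜ, |f x| ^ (p - 1) * ‖x - z‖ ^ (-((n : ℝ) + s * p))) ^ (1/(p-1))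

/-- Membership in the tail space `L^{p-1}_{sp}(ℝ^n)`. -/
def MemTail (n : ℕ) (s p : ℝ) (f : Euc n → ℝ) : Prop :=
  AEMeasurable f volume ∧
  (∀ z : Euc n, ∀ r : ℝ, 0 < r → IntegrableOn (fun x => |f x| ^ (p - 1)) (ball z r) volume) ∧
  (∀ z : Euc n, ∀ r : ℝ, 0 < r →
    IntegrableOn (fun x => |f x| ^ (p - 1) * ‖x - z‖ ^ (-((n : ℝ) + s * p))) (ball z r)ᶜ volume)

/-- The admissible class `K_{g,h}(Ω,Ω')`. -/
def obstacleSet (n : ℕ) (s p : ℝ) (Ω Ω' : Set (Euc n)) (g : Euc n → ℝ) (h : Euc n → EReal) :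
    Set (Euc n → ℝ) :=
  {u | MemW n s p Ω' u ∧ (∀ᵐ x ∂(volume : Measure (Euc n)), x ∈ Ω → h x ≤ (u x : EReal)) ∧
    (∀ᵐ x ∂(volume : Measure (Euc n)), x ∉ Ω → u x = g x)}

/-- The functional `A u (v)`. -/
noncomputable def Aop (n : ℕ) (p : ℝ) (Ω Ω' : Set (Euc n)) (g : Euc n → ℝ)
    (K : Euc n → Euc n → ℝ) (u v : Euc n → ℝ) : ℝ :=
  (∫ x in Ω', ∫ y in Ω', Lf p (u x) (u y) * (v x - v y) * K x y) +
  2 * ∫ y in Ω'ᶜ, ∫ x in Ω, Lf p (u x) (g y) * v x * K x y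

/-- `u` solves the obstacle problem in `K_{g,h}(Ω,Ω')`. -/
def SolvesObstacle (n : ℕ) (s p : ℝ) (Ω Ω' : Set (Euc n)) (g : Euc n → ℝ) (h : Euc n → EReal)
    (K : Euc n → Euc n → ℝ) (u : Euc n → ℝ) : Prop :=
  u ∈ obstacleSet n s p Ω Ω' g h ∧
  ∀ v ∈ obstacleSet n s p Ω Ω' g h, 0 ≤ Aop n p Ω Ω' g K u (fun x => v x - u x)

/-- The essential oscillation of `f` on `A` (in `EReal`). -/
noncomputable def essOsc (n : ℕ) (A : Set (Euc n)) (f : Euc n → ℝ) : EReal :=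
  essSup (fun x => (f x : EReal)) (volume.restrict A) -
    essInf (fun x => (f x : EReal)) (volume.restrict A)

end

lemma aux_ball_int (n : ℕ) (hn : 1 ≤ n) (a R : ℝ) (ha : 0 < a) :
    IntegrableOn (fun x : Euc n => ‖x‖ ^ (a - (n : ℝ))) (ball 0 R) volume := by
  have : Nonempty (Fin n) := ⟨⟨0, hn⟩⟩
  have : Nontrivial (Euc n) := inferInstance
  rw [integrableOn_fun_norm_addHaar (E := Euc n) volume (f := fun t : ℝ => t ^ (a - (n : ℝ)))]
  rcases le_or_gt R 0 with hR | hR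
  · simp [Set.Ioo_eq_empty (not_lt.mpr hR)]
  have h1 : IntervalIntegrable (fun t : ℝ => t ^ (a - 1)) volume 0 R :=
    intervalIntegral.intervalIntegrable_rpow' (by linarith)
  rw [intervalIntegrable_iff_integrableOn_Ioo_of_le hR.le] at h1
  refine h1.congr_fun ?_ measurableSet_Ioo
  intro t ht
  have ht0 : 0 < t := ht.1
  simp only [finrank_euclideanSpace, Fintype.card_fin, smul_eq_mul]
  rw [← Real.rpow_natCast, ← Real.rpow_add ht0]
  congr 1
  rw [Nat.cast_sub hn]
  push_cast; ring

lemma aux_gag_bound (n : ℕ) (hn : 1 ≤ n) (a : ℝ) (ha : 0 < a) (D : Set (Euc n))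
    (hD : Bornology.IsBounded D) :
    Integrable (fun q : Euc n × Euc n => ‖q.1 - q.2‖ ^ (a - (n : ℝ)))
      ((volume.restrict D).prod (volume.restrict D)) := by
  obtain ⟨R, hR⟩ := hD.subset_ball 0
  suffices hB : Integrable (fun q : Euc n × Euc n => ‖q.1 - q.2‖ ^ (a - (n : ℝ)))
      ((volume.restrict (ball 0 R)).prod (volume.restrict (ball 0 R))) by
    refine hB.mono_measure ?_
    exact Measure.prod_mono (Measure.restrict_mono hR le_rfl) (Measure.restrict_mono hR le_rfl)
  set k : Euc n → ℝ := (ball (0 : Euc n) (2 * R)).indicator (fun x => ‖x‖ ^ (a - (n : ℝ))) with hk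
  have hkm : Measurable k := Measurable.indicator (by fun_prop) measurableSet_ball
  have hki : Integrable k volume :=
    (integrable_indicator_iff measurableSet_ball).2 (aux_ball_int n hn a (2 * R) ha)
  have h1 : Integrable (fun q : Euc n × Euc n => k (q.1 - q.2))
      ((volume.restrict (ball 0 R)).prod volume) := by
    have hm : AEStronglyMeasurable (fun q : Euc n × Euc n => k (q.1 - q.2))
        ((volume.restrict (ball 0 R)).prod volume) :=
      (hkm.comp (by fun_prop)).aestronglyMeasurable
    rw [integrable_prod_iff hm]
    constructor
    · exact Eventually.of_forall fun x => hki.comp_sub_left x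
    · have : ∀ x : Euc n, ∫ y, ‖k (x - y)‖ = ∫ y, ‖k y‖ := fun x =>
        integral_sub_left_eq_self (fun y => ‖k y‖) volume x
      simp only [this]
      have : IsFiniteMeasure (volume.restrict (ball (0 : Euc n) R)) :=
        ⟨by simpa using measure_ball_lt_top⟩
      exact integrable_const _
  have h2 : Integrable (fun q : Euc n × Euc n => k (q.1 - q.2))
      ((volume.restrict (ball 0 R)).prod (volume.restrict (ball 0 R))) :=
    h1.mono_measure (Measure.prod_mono le_rfl Measure.restrict_le_self)
  refine h2.congr ?_
  rw [Measure.prod_restrict]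
  filter_upwards [ae_restrict_mem (measurableSet_ball.prod measurableSet_ball)] with q hq
  obtain ⟨hq1, hq2⟩ := hq
  rw [mem_ball_zero_iff] at hq1 hq2
  simp only [hk]
  rw [Set.indicator_of_mem]
  rw [mem_ball_zero_iff]
  calc ‖q.1 - q.2‖ ≤ ‖q.1‖ + ‖q.2‖ := norm_sub_le _ _
    _ < 2 * R := by linarith

lemma aux_test_memW (n : ℕ) (s p : ℝ) (hn : 1 ≤ n) (hs1 : s < 1) (hp : 1 < p)
    (D : Set (Euc n)) (hD : Bornology.IsBounded D)
    (η : Euc n → ℝ) (hη : ContDiff ℝ (⊤ : ℕ∞) η) (hc : HasCompactSupport η) :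
    MemW n s p D η := by
  obtain ⟨C, hC⟩ := ContDiff.lipschitzWith_of_hasCompactSupport hc hη (by simp)
  obtain ⟨M, hM⟩ := hc.exists_bound_of_continuous hη.continuous
  have hηm : Measurable η := hη.continuous.measurable
  refine ⟨hηm.aemeasurable, ?_, ?_⟩
  · have : Continuous (fun x => |η x| ^ p) :=
      hη.continuous.abs.rpow_const (fun x => Or.inr (by linarith))
    have hcs : HasCompactSupport (fun x => |η x| ^ p) := by
      refine hc.comp_left (g := fun t : ℝ => |t| ^ p) ?_
      simp [Real.zero_rpow (by linarith : p ≠ 0)]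
    exact (this.integrable_of_hasCompactSupport hcs).integrableOn
  · have hb := (aux_gag_bound n hn ((1 - s) * p) (by nlinarith) D hD).const_mul ((C : ℝ) ^ p)
    refine hb.mono' ?_ ?_
    · exact Measurable.aestronglyMeasurable (by fun_prop)
    · refine Eventually.of_forall fun q => ?_
      have h0 : 0 ≤ |η q.1 - η q.2| ^ p / ‖q.1 - q.2‖ ^ ((n : ℝ) + s * p) := by positivity
      rw [Real.norm_of_nonneg h0]
      rcases eq_or_ne q.1 q.2 with h | h
      · rw [h]
        simp only [sub_self, abs_zero, Real.zero_rpow (by linarith : p ≠ 0), zero_div]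
        positivity
      · have hpos : 0 < ‖q.1 - q.2‖ := norm_pos_iff.2 (sub_ne_zero.2 h)
        have hl : |η q.1 - η q.2| ≤ C * ‖q.1 - q.2‖ := by
          have := hC.dist_le_mul q.1 q.2
          rwa [Real.dist_eq, dist_eq_norm] at this
        rw [div_le_iff₀ (by positivity), mul_assoc, ← Real.rpow_add hpos]
        calc |η q.1 - η q.2| ^ p ≤ (C * ‖q.1 - q.2‖) ^ p :=
              Real.rpow_le_rpow (abs_nonneg _) hl (by linarith)
          _ = (C : ℝ) ^ p * ‖q.1 - q.2‖ ^ p := Real.mul_rpow (by positivity) (by positivity)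
          _ = _ := by congr 2; ring

lemma aux_rpow_add (p a b : ℝ) (hp : 0 ≤ p) :
    |a + b| ^ p ≤ 2 ^ p * (|a| ^ p + |b| ^ p) := by
  have h1 : |a + b| ≤ 2 * max |a| |b| := by
    have := abs_add_le a b
    have := le_max_left |a| |b|
    have := le_max_right |a| |b|
    linarith
  calc |a + b| ^ p ≤ (2 * max |a| |b|) ^ p := Real.rpow_le_rpow (abs_nonneg _) h1 hp
    _ = 2 ^ p * (max |a| |b|) ^ p := Real.mul_rpow (by norm_num) (by positivity)
    _ ≤ _ := by
      gcongr
      have ha : 0 ≤ |a| ^ p := by positivity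
      have hb : 0 ≤ |b| ^ p := by positivity
      rcases max_cases |a| |b| with h | h <;> rw [h.1] <;> linarith

lemma aux_memW_add (n : ℕ) (s p : ℝ) (hp : 1 < p)
    (D : Set (Euc n)) (u v : Euc n → ℝ) (hu : MemW n s p D u) (hv : MemW n s p D v) :
    MemW n s p D (fun x => u x + v x) := by
  obtain ⟨u1, u2, u3⟩ := hu
  obtain ⟨v1, v2, v3⟩ := hv
  refine ⟨u1.add v1, ?_, ?_⟩
  · refine ((u2.add v2).const_mul (2 ^ p)).mono' ?_ ?_
    · have := u1.add v1
      exact (AEMeasurable.pow_const (this.norm) p).aestronglyMeasurable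
    · refine Eventually.of_forall fun x => ?_
      rw [Real.norm_of_nonneg (by positivity)]
      exact aux_rpow_add p (u x) (v x) (by linarith)
  · refine ((u3.add v3).const_mul (2 ^ p)).mono' ?_ ?_
    · have hw := u1.add v1
      have h1 := hw.comp_fst (ν := volume.restrict D)
      have h2 := hw.comp_snd (μ := volume.restrict D)
      have h3 := AEMeasurable.pow_const ((h1.sub h2).norm) p
      refine (h3.div (g := fun q : Euc n × Euc n => ‖q.1 - q.2‖ ^ ((n : ℝ) + s * p)) ?_).aestronglyMeasurable
      exact Measurable.aemeasurable (by fun_prop)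
    · refine Eventually.of_forall fun q => ?_
      rw [Real.norm_of_nonneg (by positivity)]
      simp only [Pi.add_apply]
      rw [← add_div, ← mul_div_assoc]
      gcongr
      have := aux_rpow_add p (u q.1 - u q.2) (v q.1 - v q.2) (by linarith)
      have e : u q.1 + v q.1 - (u q.2 + v q.2) = u q.1 - u q.2 + (v q.1 - v q.2) := by ring
      rw [e]
      exact this

lemma aux_Lf_abs (p a b : ℝ) (hp : 1 < p) : |Lf p a b| = |a - b| ^ (p - 1) := by
  unfold Lf
  rcases eq_or_ne (a - b) 0 with h | h
  · rw [h]; simp [Real.zero_rpow (by linarith : p - 1 ≠ 0)]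
  · have : 0 < |a - b| := abs_pos.2 h
    rw [abs_mul, abs_of_nonneg (by positivity : 0 ≤ |a - b| ^ (p - 2))]
    nth_rewrite 2 [← Real.rpow_one |a - b|]
    rw [← Real.rpow_add this]
    congr 1; ring

lemma aux_Lf_symm (p a b : ℝ) : Lf p a b = - Lf p b a := by
  unfold Lf
  rw [abs_sub_comm]; ring

lemma aux_young (p a b : ℝ) (hp : 1 < p) (ha : 0 ≤ a) (hb : 0 ≤ b) :
    a ^ (p - 1) * b ≤ a ^ p + b ^ p := by
  have ha' : 0 ≤ a ^ p := by positivity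
  have hb' : 0 ≤ b ^ p := by positivity
  have key : ∀ t : ℝ, 0 ≤ t → t ^ (p - 1) * t = t ^ p := by
    intro t ht
    rcases ht.eq_or_lt with h | h
    · rw [← h]; simp [Real.zero_rpow (by linarith : p ≠ 0)]
    · nth_rewrite 2 [← Real.rpow_one t]
      rw [← Real.rpow_add h]; congr 1; ring
  rcases le_total a b with h | h
  · have : a ^ (p - 1) * b ≤ b ^ (p - 1) * b := by
      gcongr
    rw [key b hb] at this; linarith
  · have : a ^ (p - 1) * b ≤ a ^ (p - 1) * a := by gcongr
    rw [key a ha] at this; linarith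

/-- The integrand of the weak formulation. -/
noncomputable def auxF (n : ℕ) (p : ℝ) (K : Euc n → Euc n → ℝ) (u η : Euc n → ℝ)
    (q : Euc n × Euc n) : ℝ := K q.1 q.2 * Lf p (u q.1) (u q.2) * (η q.1 - η q.2)

lemma auxF_meas (n : ℕ) (p : ℝ) (K : Euc n → Euc n → ℝ) (hK : Measurable (Function.uncurry K))
    (u η : Euc n → ℝ) (hu : AEMeasurable u volume) (hη : Measurable η) :
    AEMeasurable (auxF n p K u η) ((volume : Measure (Euc n)).prod volume) := by
  have hd : AEMeasurable (fun q : Euc n × Euc n => u q.1 - u q.2)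
      ((volume : Measure (Euc n)).prod volume) :=
    (hu.comp_fst (ν := volume)).sub (hu.comp_snd (μ := volume))
  have hL : AEMeasurable (fun q : Euc n × Euc n => Lf p (u q.1) (u q.2))
      ((volume : Measure (Euc n)).prod volume) :=
    (AEMeasurable.pow_const hd.norm (p - 2)).mul hd
  have hE : Measurable (fun q : Euc n × Euc n => η q.1 - η q.2) := by fun_prop
  exact (AEMeasurable.mul (hK.aemeasurable : AEMeasurable (fun q : Euc n × Euc n => K q.1 q.2) _)
    hL).mul hE.aemeasurable

lemma auxF_swap (n : ℕ) (p : ℝ) (K : Euc n → Euc n → ℝ) (hK : ∀ x y, K x y = K y x)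
    (u η : Euc n → ℝ) (q : Euc n × Euc n) : auxF n p K u η q.swap = auxF n p K u η q := by
  unfold auxF
  simp only [Prod.fst_swap, Prod.snd_swap]
  rw [hK q.2 q.1, aux_Lf_symm p (u q.2)]; ring

lemma auxF_int_diag (n : ℕ) (s p Λ : ℝ) (hp : 1 < p) (hΛ : 1 ≤ Λ)
    (K : Euc n → Euc n → ℝ) (hK : IsKernel n s p Λ K) (D : Set (Euc n))
    (u η : Euc n → ℝ) (hu : AEMeasurable u volume) (hη : Measurable η)
    (huW : MemW n s p D u) (hηW : MemW n s p D η) :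
    Integrable (auxF n p K u η) ((volume.restrict D).prod (volume.restrict D)) := by
  obtain ⟨hKm, hKs, hK0, hKb⟩ := hK
  have hle : (volume.restrict D).prod (volume.restrict D) ≤
      ((volume : Measure (Euc n)).prod volume) :=
    Measure.prod_mono Measure.restrict_le_self Measure.restrict_le_self
  refine ((huW.2.2.add hηW.2.2).const_mul Λ).mono'
    ((auxF_meas n p K hKm u η hu hη).mono_measure hle).aestronglyMeasurable ?_
  rw [Measure.volume_eq_prod] at hKb
  filter_upwards [ae_mono hle hKb] with q hq
  unfold auxF
  simp only [Pi.add_apply]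
  rcases eq_or_ne q.1 q.2 with h | h
  · rw [h]
    simp [Real.zero_rpow (by linarith : p ≠ 0)]
  · have hpos : 0 < ‖q.1 - q.2‖ := norm_pos_iff.2 (sub_ne_zero.2 h)
    have hr : 0 < ‖q.1 - q.2‖ ^ ((n : ℝ) + s * p) := by positivity
    have hk : K q.1 q.2 ≤ Λ / ‖q.1 - q.2‖ ^ ((n : ℝ) + s * p) := by
      rw [le_div_iff₀ hr]; exact hq.2
    rw [Real.norm_eq_abs, abs_mul, abs_mul, aux_Lf_abs p _ _ hp, abs_of_nonneg (hK0 _ _), mul_assoc]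
    calc _ ≤ Λ / ‖q.1 - q.2‖ ^ ((n : ℝ) + s * p) *
          (|u q.1 - u q.2| ^ p + |η q.1 - η q.2| ^ p) := by
          gcongr
          exact aux_young p _ _ hp (abs_nonneg _) (abs_nonneg _)
      _ = _ := by ring

lemma aux_tail_int (n : ℕ) (s p : ℝ) (hs0 : 0 < s) (hp : 1 < p) (g : Euc n → ℝ)
    (hgt : MemTail n s p g) :
    Integrable (fun y : Euc n => (1 + |g y| ^ (p - 1)) * (1 + ‖y‖) ^ (-((n : ℝ) + s * p)))
      volume := by
  have hsp : 0 < s * p := by nlinarith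
  have h1 : Integrable (fun y : Euc n => (1 + ‖y‖) ^ (-((n : ℝ) + s * p))) volume := by
    apply integrable_one_add_norm
    simp; exact hsp
  have hm : AEStronglyMeasurable (fun y : Euc n => |g y| ^ (p - 1) *
      (1 + ‖y‖) ^ (-((n : ℝ) + s * p))) volume := by
    have h1 : Measurable (fun y : Euc n => (1 + ‖y‖) ^ (-((n : ℝ) + s * p))) := by fun_prop
    exact ((AEMeasurable.pow_const hgt.1.norm (p - 1)).mul h1.aemeasurable).aestronglyMeasurable
  have h2 : Integrable (fun y : Euc n => |g y| ^ (p - 1) *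
      (1 + ‖y‖) ^ (-((n : ℝ) + s * p))) volume := by
    rw [← integrableOn_univ, ← Set.union_compl_self (ball (0 : Euc n) 1)]
    refine IntegrableOn.union ?_ ?_
    · refine (hgt.2.1 0 1 one_pos).mono' hm.restrict (Eventually.of_forall fun y => ?_)
      rw [Real.norm_of_nonneg (by positivity)]
      refine mul_le_of_le_one_right (by positivity) ?_
      apply Real.rpow_le_one_of_one_le_of_nonpos
      · linarith [norm_nonneg y]
      · have : (0 : ℝ) ≤ n := by positivity
        linarith
    · refine (hgt.2.2 0 1 one_pos).mono' hm.restrict ?_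
      filter_upwards [ae_restrict_mem measurableSet_ball.compl] with y hy
      rw [Real.norm_of_nonneg (by positivity)]
      have hy1 : 1 ≤ ‖y‖ := by simpa using hy
      rw [sub_zero]
      refine mul_le_mul_of_nonneg_left ?_ (by positivity)
      apply Real.rpow_le_rpow_of_nonpos (by linarith) (by linarith)
      have : (0 : ℝ) ≤ n := by positivity
      linarith
  refine (h1.add h2).congr (Eventually.of_forall fun y => ?_)
  simp only [Pi.add_apply]; ring

lemma auxF_int_off (n : ℕ) (s p Λ : ℝ) (hs0 : 0 < s) (hp : 1 < p) (hΛ : 1 ≤ Λ)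
    (K : Euc n → Euc n → ℝ) (hK : IsKernel n s p Λ K) (D : Set (Euc n)) (hDo : IsOpen D)
    (hDb : Bornology.IsBounded D)
    (u g η : Euc n → ℝ) (hu : AEMeasurable u volume) (hη : ContDiff ℝ (⊤ : ℕ∞) η)
    (hc : HasCompactSupport η) (hsub : tsupport η ⊆ D)
    (huW : MemW n s p D u) (hgt : MemTail n s p g)
    (hug : ∀ᵐ x ∂(volume : Measure (Euc n)), x ∉ D → u x = g x) :
    Integrable (auxF n p K u η) ((volume.restrict D).prod (volume.restrict Dᶜ)) := by
  obtain ⟨hKm, hKs, hK0, hKb⟩ := hK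
  have hle : (volume.restrict D).prod (volume.restrict Dᶜ) ≤
      ((volume : Measure (Euc n)).prod volume) :=
    Measure.prod_mono Measure.restrict_le_self Measure.restrict_le_self
  have hsp : 0 < s * p := by nlinarith
  have hnsp : 0 < (n : ℝ) + s * p := by positivity
  obtain ⟨M, hM⟩ := hc.exists_bound_of_continuous hη.continuous
  have hM0 : 0 ≤ M := (norm_nonneg _).trans (hM 0)
  obtain ⟨d, hd, hdsub⟩ := IsCompact.exists_thickening_subset_open hc hDo hsub
  obtain ⟨R0, hR0⟩ := hDb.subset_ball 0
  set R := max R0 0 with hRdef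
  have hR : 0 ≤ R := le_max_right _ _
  set c : ℝ := 1 + (1 + R) / d with hcdef
  have hc0 : 0 < c := by positivity
  -- integrability of the u factor
  have hfin : IsFiniteMeasure (volume.restrict D) := ⟨by
    simpa using hDb.measure_lt_top⟩
  have hU : Integrable (fun x => 1 + |u x| ^ (p - 1)) (volume.restrict D) := by
    refine ((integrable_const (2 : ℝ)).add huW.2.1).mono' ?_ ?_
    · exact ((AEMeasurable.pow_const huW.1.norm (p - 1)).const_add 1).aestronglyMeasurable
    · refine Eventually.of_forall fun x => ?_
      rw [Real.norm_of_nonneg (by positivity)]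
      have := aux_young p |u x| 1 hp (abs_nonneg _) zero_le_one
      simp only [mul_one, Real.one_rpow] at this
      simp only [Pi.add_apply]
      linarith
  have hG := (hU.mul_prod ((aux_tail_int n s p hs0 hp g hgt).restrict (s := Dᶜ))).const_mul
    (Λ * c ^ ((n : ℝ) + s * p) * 2 ^ (p - 1) * M)
  refine hG.mono' ((auxF_meas n p K hKm u η hu hη.continuous.measurable).mono_measure
    hle).aestronglyMeasurable ?_
  rw [Measure.volume_eq_prod] at hKb
  have hug' : ∀ᵐ q ∂((volume.restrict D).prod (volume.restrict Dᶜ)), q.2 ∉ D → u q.2 = g q.2 :=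
    ae_mono hle (Measure.quasiMeasurePreserving_snd.ae hug)
  have hmem : ∀ᵐ q ∂((volume.restrict D).prod (volume.restrict Dᶜ)), q ∈ D ×ˢ Dᶜ := by
    rw [Measure.prod_restrict]
    exact ae_restrict_mem (hDo.measurableSet.prod hDo.measurableSet.compl)
  filter_upwards [ae_mono hle hKb, hug', hmem] with q hq hqg hqD
  obtain ⟨hq1, hq2⟩ := hqD
  have hη2 : η q.2 = 0 := image_eq_zero_of_notMem_tsupport fun h => hq2 (hsub h)
  unfold auxF
  rw [hη2, sub_zero, hqg hq2]
  by_cases h1 : q.1 ∈ tsupport η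
  · have hdist : d ≤ ‖q.1 - q.2‖ := by
      by_contra hlt
      push Not at hlt
      apply hq2
      apply hdsub
      rw [mem_thickening_iff]
      exact ⟨q.1, h1, by rwa [dist_comm, dist_eq_norm]⟩
    have hpos : 0 < ‖q.1 - q.2‖ := hd.trans_le hdist
    have hr : 0 < ‖q.1 - q.2‖ ^ ((n : ℝ) + s * p) := by positivity
    have hq1R : ‖q.1‖ ≤ R := by
      have := hR0 hq1
      rw [mem_ball_zero_iff] at this
      exact this.le.trans (le_max_left _ _)
    have hcomp : 1 + ‖q.2‖ ≤ c * ‖q.1 - q.2‖ := by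
      have t1 : ‖q.2‖ ≤ ‖q.1‖ + ‖q.1 - q.2‖ := by
        have := norm_sub_le q.1 (q.1 - q.2)
        simpa using this
      have t2 : 1 + R ≤ (1 + R) / d * ‖q.1 - q.2‖ := by
        rw [div_mul_eq_mul_div, le_div_iff₀ hd]
        gcongr
      rw [hcdef, add_mul, one_mul]; linarith
    have hk : K q.1 q.2 ≤ Λ * (c ^ ((n : ℝ) + s * p) * (1 + ‖q.2‖) ^ (-((n : ℝ) + s * p))) := by
      have hk1 : K q.1 q.2 ≤ Λ / ‖q.1 - q.2‖ ^ ((n : ℝ) + s * p) := by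
        rw [le_div_iff₀ hr]; exact hq.2
      refine hk1.trans ?_
      rw [div_eq_mul_inv]
      gcongr
      rw [Real.rpow_neg (by positivity), ← div_eq_mul_inv, inv_eq_one_div,
        div_le_div_iff₀ hr (by positivity), one_mul, ← Real.mul_rpow hc0.le hpos.le]
      exact Real.rpow_le_rpow (by positivity) hcomp hnsp.le
    have hL : |u q.1 - g q.2| ^ (p - 1) ≤
        2 ^ (p - 1) * ((1 + |u q.1| ^ (p - 1)) * (1 + |g q.2| ^ (p - 1))) := by
      have := aux_rpow_add (p - 1) (u q.1) (-g q.2) (by linarith)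
      rw [abs_neg, ← sub_eq_add_neg] at this
      refine this.trans ?_
      gcongr
      have a1 : 0 ≤ |u q.1| ^ (p - 1) := by positivity
      have a2 : 0 ≤ |g q.2| ^ (p - 1) := by positivity
      nlinarith
    rw [Real.norm_eq_abs, abs_mul, abs_mul, aux_Lf_abs p _ _ hp, abs_of_nonneg (hK0 _ _)]
    calc _ ≤ (Λ * (c ^ ((n : ℝ) + s * p) * (1 + ‖q.2‖) ^ (-((n : ℝ) + s * p)))) *
          (2 ^ (p - 1) * ((1 + |u q.1| ^ (p - 1)) * (1 + |g q.2| ^ (p - 1)))) * M := by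
          gcongr
          exact hM q.1
      _ = _ := by ring
  · rw [image_eq_zero_of_notMem_tsupport h1]
    simp only [mul_zero, norm_zero]
    positivity

lemma auxF_split (n : ℕ) (p : ℝ) (K : Euc n → Euc n → ℝ) (hKs : ∀ x y, K x y = K y x)
    (D : Set (Euc n)) (hD : MeasurableSet D) (u η : Euc n → ℝ)
    (hη0 : ∀ x, x ∉ D → η x = 0)
    (h1 : Integrable (auxF n p K u η) ((volume.restrict D).prod (volume.restrict D)))
    (h2 : Integrable (auxF n p K u η) ((volume.restrict D).prod (volume.restrict Dᶜ))) :
    (∫ x, ∫ y, auxF n p K u η (x, y)) =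
      (∫ x in D, ∫ y in D, auxF n p K u η (x, y)) +
      2 * ∫ y in Dᶜ, ∫ x in D, auxF n p K u η (x, y) := by
  set F := auxF n p K u η with hF
  have hsw : ∀ q, F q.swap = F q := auxF_swap n p K hKs u η
  have hFs : (fun q => F q.swap) = F := funext hsw
  have h3 : Integrable F ((volume.restrict Dᶜ).prod (volume.restrict D)) := by
    have := h2.swap
    exact this.congr (Eventually.of_forall fun q => hsw q)
  have hz : ∀ q ∈ Dᶜ ×ˢ Dᶜ, F q = 0 := by
    rintro q ⟨ha, hb⟩
    simp only [hF, auxF]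
    rw [hη0 _ ha, hη0 _ hb]; ring
  have h4 : Integrable F ((volume.restrict Dᶜ).prod (volume.restrict Dᶜ)) := by
    rw [Measure.prod_restrict]
    exact IntegrableOn.congr_fun integrableOn_zero (fun q hq => (hz q hq).symm)
      (hD.compl.prod hD.compl)
  have e : (volume : Measure (Euc n)).restrict D + (volume : Measure (Euc n)).restrict Dᶜ = volume :=
    Measure.restrict_add_restrict_compl hD
  have hμ : (volume : Measure (Euc n)).prod (volume : Measure (Euc n)) =
      ((volume.restrict D).prod (volume.restrict D) +
        (volume.restrict Dᶜ).prod (volume.restrict D)) +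
      ((volume.restrict D).prod (volume.restrict Dᶜ) +
        (volume.restrict Dᶜ).prod (volume.restrict Dᶜ)) := by
    conv_lhs => rw [← e]
    rw [Measure.prod_add, Measure.add_prod, Measure.add_prod]
  have hI : Integrable F ((volume : Measure (Euc n)).prod (volume : Measure (Euc n))) := by
    rw [hμ]
    exact (h1.add_measure h3).add_measure (h2.add_measure h4)
  rw [← integral_prod _ hI, hμ, integral_add_measure (h1.add_measure h3) (h2.add_measure h4),
    integral_add_measure h1 h3, integral_add_measure h2 h4]
  have z4 : ∫ q, F q ∂((volume.restrict Dᶜ).prod (volume.restrict Dᶜ)) = 0 := by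
    rw [Measure.prod_restrict]
    exact setIntegral_eq_zero_of_forall_eq_zero hz
  have z3 : ∫ q, F q ∂((volume.restrict Dᶜ).prod (volume.restrict D)) =
      ∫ y in Dᶜ, ∫ x in D, F (x, y) := by
    rw [integral_prod _ h3]
    congr 1; ext y; congr 1; ext x
    exact hsw (x, y)
  have z2 : ∫ q, F q ∂((volume.restrict D).prod (volume.restrict Dᶜ)) =
      ∫ y in Dᶜ, ∫ x in D, F (x, y) := integral_prod_symm _ h2
  rw [z4, z3, z2, integral_prod _ h1]; ring

lemma auxF_eq_Aop (n : ℕ) (s p Λ : ℝ) (hn : 1 ≤ n) (hs0 : 0 < s) (hs1 : s < 1) (hp : 1 < p)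
    (hΛ : 1 ≤ Λ) (K : Euc n → Euc n → ℝ) (hK : IsKernel n s p Λ K)
    (Ω Ω' : Set (Euc n)) (hΩo : IsOpen Ω) (hΩ'o : IsOpen Ω')
    (hΩ'b : Bornology.IsBounded Ω') (hΩΩ' : Ω ⊆ Ω')
    (g : Euc n → ℝ) (hgt : MemTail n s p g)
    (u : Euc n → ℝ) (huW : MemW n s p Ω' u)
    (hug : ∀ᵐ x ∂(volume : Measure (Euc n)), x ∉ Ω → u x = g x)
    (η : Euc n → ℝ) (hη : ContDiff ℝ (⊤ : ℕ∞) η)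
    (hc : HasCompactSupport η) (hsub : tsupport η ⊆ Ω) :
    (∫ x, ∫ y, K x y * Lf p (u x) (u y) * (η x - η y)) = Aop n p Ω Ω' g K u η := by
  have hu : AEMeasurable u volume := by
    rw [← Measure.restrict_add_restrict_compl (μ := volume) hΩ'o.measurableSet]
    refine huW.1.add_measure ?_
    refine (hgt.1.restrict (s := Ω'ᶜ)).congr ?_
    filter_upwards [ae_restrict_mem hΩ'o.measurableSet.compl, ae_restrict_of_ae hug] with x hx hx2
    exact (hx2 fun h => hx (hΩΩ' h)).symm
  have hug' : ∀ᵐ x ∂(volume : Measure (Euc n)), x ∉ Ω' → u x = g x := by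
    filter_upwards [hug] with x hx hx2
    exact hx fun h => hx2 (hΩΩ' h)
  have h1 := auxF_int_diag n s p Λ hp hΛ K hK Ω' u η hu hη.continuous.measurable huW
    (aux_test_memW n s p hn hs1 hp Ω' hΩ'b η hη hc)
  have h2 := auxF_int_off n s p Λ hs0 hp hΛ K hK Ω' hΩ'o hΩ'b u g η hu hη hc
    (hsub.trans hΩΩ') huW hgt hug'
  have hη0 : ∀ x, x ∉ Ω → η x = 0 := fun x hx =>
    image_eq_zero_of_notMem_tsupport fun h => hx (hsub h)
  have := auxF_split n p K hK.2.1 Ω' hΩ'o.measurableSet u η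
    (fun x hx => hη0 x fun h => hx (hΩΩ' h)) h1 h2
  simp only [auxF] at this
  rw [this]
  unfold Aop
  congr 1
  · congr 1; ext x; congr 1; ext y; ring
  · congr 1
    apply integral_congr_ae
    filter_upwards [ae_restrict_mem hΩ'o.measurableSet.compl, ae_restrict_of_ae hug'] with y hy hy2
    have hηy : η y = 0 := hη0 y fun h => hy (hΩΩ' h)
    rw [hy2 hy, hηy]
    rw [setIntegral_eq_of_subset_of_forall_sdiff_eq_zero hΩ'o.measurableSet hΩΩ'
      (f := fun x => K x y * Lf p (u x) (g y) * (η x - 0))]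
    · congr 1; ext x; ring
    · intro x hx
      rw [hη0 x hx.2]; ring

lemma aux_Aop_smul (n : ℕ) (p : ℝ) (Ω Ω' : Set (Euc n)) (g : Euc n → ℝ)
    (K : Euc n → Euc n → ℝ) (u η : Euc n → ℝ) (c : ℝ) :
    Aop n p Ω Ω' g K u (fun x => c * η x) = c * Aop n p Ω Ω' g K u η := by
  unfold Aop
  have e1 : ∀ x y, Lf p (u x) (u y) * (c * η x - c * η y) * K x y =
      c * (Lf p (u x) (u y) * (η x - η y) * K x y) := fun x y => by ring
  have e2 : ∀ x y, Lf p (u x) (g y) * (c * η x) * K x y =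
      c * (Lf p (u x) (g y) * η x * K x y) := fun x y => by ring
  simp only [e1, e2, integral_const_mul]
  ring

lemma aux_core
    (n : ℕ) (s p Λ : ℝ) (hn : 1 ≤ n) (hs0 : 0 < s) (hs1 : s < 1) (hp : 1 < p)
    (hΛ : 1 ≤ Λ) (K : Euc n → Euc n → ℝ) (hK : IsKernel n s p Λ K)
    (Ω Ω' : Set (Euc n)) (hΩo : IsOpen Ω) (hΩ'o : IsOpen Ω')
    (hΩ'b : Bornology.IsBounded Ω') (hΩΩ' : Ω ⊆ Ω')
    (g : Euc n → ℝ) (h : Euc n → EReal) (hgt : MemTail n s p g)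
    (u : Euc n → ℝ) (hu : SolvesObstacle n s p Ω Ω' g h K u)
    (η : Euc n → ℝ) (hη : ContDiff ℝ (⊤ : ℕ∞) η)
    (hc : HasCompactSupport η) (hsub : tsupport η ⊆ Ω) (δ : ℝ) (hδ : 0 < δ)
    (hgap : ∀ᵐ x ∂(volume : Measure (Euc n)), x ∈ tsupport η → h x ≤ ((u x - δ : ℝ) : EReal)) :
    (∫ x, ∫ y, K x y * Lf p (u x) (u y) * (η x - η y)) = 0 := by
  obtain ⟨⟨huW, huh, hug⟩, hmin⟩ := hu
  rw [auxF_eq_Aop n s p Λ hn hs0 hs1 hp hΛ K hK Ω Ω' hΩo hΩ'o hΩ'b hΩΩ' g hgt u huW hug η hη hc hsub]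
  obtain ⟨M, hM⟩ := hc.exists_bound_of_continuous hη.continuous
  have hM0 : 0 ≤ M := (norm_nonneg _).trans (hM 0)
  set ε : ℝ := δ / (M + 1) with hε
  have hε0 : 0 < ε := by positivity
  have key : ∀ c : ℝ, |c| ≤ ε → 0 ≤ c * Aop n p Ω Ω' g K u η := by
    intro c hcε
    have hηc : ContDiff ℝ (⊤ : ℕ∞) (fun x => c * η x) := contDiff_const.mul hη
    have hcc : HasCompactSupport (fun x => c * η x) := hc.mul_left
    have hv : (fun x => u x + c * η x) ∈ obstacleSet n s p Ω Ω' g h := by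
      refine ⟨aux_memW_add n s p hp Ω' u _ huW
        (aux_test_memW n s p hn hs1 hp Ω' hΩ'b _ hηc hcc), ?_, ?_⟩
      · filter_upwards [huh, hgap] with x hx1 hx2 hxΩ
        by_cases hxs : x ∈ tsupport η
        · refine (hx2 hxs).trans ?_
          rw [EReal.coe_le_coe_iff]
          have : |c * η x| ≤ δ := by
            rw [abs_mul]
            calc |c| * |η x| ≤ ε * (M + 1) := by
                  gcongr
                  have := hM x
                  rw [Real.norm_eq_abs] at this
                  linarith
              _ = δ := by rw [hε]; field_simp
          linarith [neg_abs_le (c * η x)]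
        · rw [image_eq_zero_of_notMem_tsupport hxs]
          simpa using hx1 hxΩ
      · filter_upwards [hug] with x hx hxΩ
        rw [image_eq_zero_of_notMem_tsupport fun h => hxΩ (hsub h)]
        simpa using hx hxΩ
    have h0 := hmin _ hv
    simp only [add_sub_cancel_left] at h0
    rwa [aux_Aop_smul] at h0
  have k1 := key ε (abs_of_pos hε0).le
  have k2 := key (-ε) (by rw [abs_neg]; exact (abs_of_pos hε0).le)
  have k3 : ε * Aop n p Ω Ω' g K u η = 0 := by linarith
  exact (mul_eq_zero.1 k3).resolve_left (ne_of_gt hε0)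

/-- Corollary 3.3: if `essinf_{B_r}(u − h) > 0` on a ball `B_r ⊆ Ω`, then the solution `u`
of the obstacle problem is a weak solution of `Lu = 0` in `B_r`; in particular, if `u` is
lower semicontinuous and `h` is upper semicontinuous in `Ω`, then `u` is a weak solution in
the open set `Ω₊ = {x ∈ Ω : u(x) > h(x)}`. -/
theorem obstacle_solution_solves_off_contact_set
    (n : ℕ) (s p Λ : ℝ) (hn : 1 ≤ n) (hs0 : 0 < s) (hs1 : s < 1) (hp : 1 < p)
    (hΛ : 1 ≤ Λ) (K : Euc n → Euc n → ℝ) (hK : IsKernel n s p Λ K)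
    (Ω Ω' : Set (Euc n)) (hΩo : IsOpen Ω) (hΩ'o : IsOpen Ω')
    (hΩb : Bornology.IsBounded Ω) (hΩ'b : Bornology.IsBounded Ω') (hΩΩ' : closure Ω ⊆ Ω')
    (g : Euc n → ℝ) (h : Euc n → EReal)
    (hg : MemW n s p Ω' g) (hgt : MemTail n s p g)
    (hne : (obstacleSet n s p Ω Ω' g h).Nonempty)
    (u : Euc n → ℝ) (hu : SolvesObstacle n s p Ω Ω' g h K u) :
    (∀ (z : Euc n) (r : ℝ), 0 < r → ball z r ⊆ Ω →
      0 < essInf (fun x => (u x : EReal) - h x) (volume.restrict (ball z r)) →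
      ∀ η : Euc n → ℝ, ContDiff ℝ (⊤ : ℕ∞) η → HasCompactSupport η → tsupport η ⊆ ball z r →
        (∫ x, ∫ y, K x y * Lf p (u x) (u y) * (η x - η y)) = 0) ∧
    (LowerSemicontinuousOn u Ω → UpperSemicontinuousOn h Ω →
      ∀ η : Euc n → ℝ, ContDiff ℝ (⊤ : ℕ∞) η → HasCompactSupport η →
        tsupport η ⊆ {x | x ∈ Ω ∧ h x < (u x : EReal)} →
        (∫ x, ∫ y, K x y * Lf p (u x) (u y) * (η x - η y)) = 0) := by
  have hΩsub : Ω ⊆ Ω' := subset_closure.trans hΩΩ'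
  constructor
  · intro z r hr hball hess η hη hc hsub
    obtain ⟨δ, hδ0, hδ⟩ := EReal.lt_iff_exists_real_btwn.1 hess
    have hδ0' : 0 < δ := by exact_mod_cast hδ0
    have hae := ae_lt_of_lt_essInf hδ
    rw [ae_restrict_iff' measurableSet_ball] at hae
    refine aux_core n s p Λ hn hs0 hs1 hp hΛ K hK Ω Ω' hΩo hΩ'o hΩ'b hΩsub g h hgt u hu η hη hc
      (hsub.trans hball) δ hδ0' ?_
    filter_upwards [hae] with x hx hxs
    have hlt := hx (hsub hxs)
    induction hh : h x with
    | bot => exact bot_le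
    | top => rw [hh] at hlt; simp at hlt
    | coe a =>
      rw [hh] at hlt
      have h1 : δ < u x - a := by exact_mod_cast hlt
      rw [EReal.coe_le_coe_iff]
      linarith
  · intro hul hhu η hη hc hsub
    have hsubΩ : tsupport η ⊆ Ω := fun x hx => (hsub hx).1
    obtain ⟨δ, hδ0, hδ⟩ : ∃ δ : ℝ, 0 < δ ∧ ∀ x ∈ tsupport η, h x ≤ ((u x - δ : ℝ) : EReal) := by
      refine IsCompact.induction_on (p := fun S => ∃ δ : ℝ, 0 < δ ∧
        ∀ x ∈ S, h x ≤ ((u x - δ : ℝ) : EReal)) hc ⟨1, one_pos, by simp⟩ ?_ ?_ ?_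
      · rintro S T hST ⟨δ, h0, h1⟩
        exact ⟨δ, h0, fun x hx => h1 x (hST hx)⟩
      · rintro S T ⟨δ, h0, h1⟩ ⟨δ', h0', h1'⟩
        refine ⟨min δ δ', lt_min h0 h0', ?_⟩
        rintro x (hx | hx)
        · refine (h1 x hx).trans (EReal.coe_le_coe_iff.2 ?_)
          linarith [min_le_left δ δ']
        · refine (h1' x hx).trans (EReal.coe_le_coe_iff.2 ?_)
          linarith [min_le_right δ δ']
      · intro x hx
        obtain ⟨hxΩ, hxu⟩ := hsub hx
        obtain ⟨b, hb1, hb2⟩ := EReal.lt_iff_exists_real_btwn.1 hxu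
        have hb2' : b < u x := by exact_mod_cast hb2
        obtain ⟨d, hd1, hd2⟩ := exists_between hb2'
        have e1 := hhu x hxΩ b hb1
        have e2 := hul x hxΩ d hd2
        refine ⟨{y | h y < b ∧ d < u y}, ?_, d - b, by linarith, ?_⟩
        · exact nhdsWithin_mono x hsubΩ (e1.and e2)
        · rintro y ⟨hy1, hy2⟩
          refine hy1.le.trans (EReal.coe_le_coe_iff.2 ?_)
          linarith
    exact aux_core n s p Λ hn hs0 hs1 hp hΛ K hK Ω Ω' hΩo hΩ'o hΩ'b hΩsub g h hgt u hu η hη hc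
      hsubΩ δ hδ0 (Eventually.of_forall hδ)
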